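/- arXiv:2006.00605 — 2 statements merged into one kernel-verified Lean document; each statement's English description precedes it below -/
import Mathlib

section
/- Let G be a finite tree on n vertices with a distinguished root vertex r. For every non-leaf vertex u choose a heavy child h(u) (a child of maximal subtree size), let H be the set of heavy edges {u, h(u)}, and let 𝒫 be the partition of V into the vertex sets of the connected components of (V, H) (the heavy path decomposition). Then for every vertex v, the unique path from r to v contains vertices from at most ⌊log₂ n⌋ + 1 distinct members of 𝒫. -/
open SimpleGraph

namespace SimpleGraph

variable {V : Type*} {G : SimpleGraph V}

/-- In a graph rooted at `r`, the set of vertices `y` such that `x` lies on every path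
from `r` to `y`. -/
def rootedSubtree (G : SimpleGraph V) (r x : V) : Set V :=
  {y : V | ∀ p : G.Path r y, x ∈ p.1.support}

lemma IsAcyclic.mem_rootedSubtree_of_isPath (hG : G.IsAcyclic) {r x y : V} {p : G.Walk r y}
    (hp : p.IsPath) (hx : x ∈ p.support) : y ∈ G.rootedSubtree r x := fun q => by
  rwa [(hG.subsingleton_path r y).elim q ⟨p, hp⟩]

lemma rootedSubtree_subset_of_mem {r u w : V} (h : w ∈ G.rootedSubtree r u) :
    G.rootedSubtree r w ⊆ G.rootedSubtree r u := fun y hy p => by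
  classical
  exact p.1.support_takeUntil_subset_support (hy p) (h ⟨_, p.2.takeUntil (hy p)⟩)

/-- Two ancestors of the same vertex are comparable. -/
lemma IsAcyclic.mem_rootedSubtree_or_mem (hG : G.IsAcyclic) {r w w' y : V} {p : G.Walk r y}
    (hp : p.IsPath) (hw : w ∈ p.support) (hw' : w' ∈ p.support) :
    w ∈ G.rootedSubtree r w' ∨ w' ∈ G.rootedSubtree r w := by
  classical
  have h := hw'
  rw [← p.take_spec hw, Walk.mem_support_append_iff] at h
  rcases h with h | h
  · exact Or.inl (hG.mem_rootedSubtree_of_isPath (hp.takeUntil hw) h)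
  · right
    have hq : ((p.takeUntil w hw).append ((p.dropUntil w hw).takeUntil w' h)).IsPath := by
      apply Walk.IsPath.of_append_left (q := (p.dropUntil w hw).dropUntil w' h)
      rwa [← Walk.append_assoc, Walk.take_spec, Walk.take_spec]
    refine hG.mem_rootedSubtree_of_isPath hq ?_
    simp [Walk.mem_support_append_iff]

lemma Connected.eq_of_mem_rootedSubtree (hG : G.Connected) {r u w : V}
    (h : w ∈ G.rootedSubtree r u) (h' : u ∈ G.rootedSubtree r w) : u = w := by
  classical
  by_contra hne
  obtain ⟨q, hq⟩ := hG.exists_isPath r u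
  have hw : w ∈ q.support := h' ⟨q, hq⟩
  exact Walk.endpoint_notMem_support_takeUntil hq hw hne (h ⟨_, hq.takeUntil hw⟩)

/-- A proper ancestor of a child of `u` is an ancestor of `u`. -/
lemma IsTree.mem_rootedSubtree_of_adj (hG : G.IsTree) {r u w x : V} (huw : G.Adj u w)
    (h : w ∈ G.rootedSubtree r u) (hx : w ∈ G.rootedSubtree r x) (hne : x ≠ w) :
    u ∈ G.rootedSubtree r x := by
  obtain ⟨q, hq⟩ := hG.1.exists_isPath r u
  have hw : w ∉ q.support := fun hw => huw.ne
    (hG.1.eq_of_mem_rootedSubtree h (hG.2.mem_rootedSubtree_of_isPath hq hw))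
  have hx' := hx ⟨_, hq.concat hw huw⟩
  simp only [Walk.support_concat, List.mem_append,
    List.mem_singleton, hne, or_false] at hx'
  exact hG.2.mem_rootedSubtree_of_isPath hq hx'

/-- The subtrees of two distinct children of a vertex are disjoint. -/
lemma IsTree.disjoint_rootedSubtree (hG : G.IsTree) {r u w w' : V}
    (huw : G.Adj u w) (h : w ∈ G.rootedSubtree r u)
    (huw' : G.Adj u w') (h' : w' ∈ G.rootedSubtree r u) (hne : w ≠ w') :
    Disjoint (G.rootedSubtree r w) (G.rootedSubtree r w') := by
  rw [Set.disjoint_left]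
  intro y hy hy'
  obtain ⟨p, hp⟩ := hG.1.exists_isPath r y
  rcases hG.2.mem_rootedSubtree_or_mem hp (hy ⟨p, hp⟩) (hy' ⟨p, hp⟩) with hc | hc
  · exact huw'.ne (hG.1.eq_of_mem_rootedSubtree h'
      (hG.mem_rootedSubtree_of_adj huw h hc hne.symm))
  · exact huw.ne (hG.1.eq_of_mem_rootedSubtree h
      (hG.mem_rootedSubtree_of_adj huw' h' hc hne))

/-- If stepping from a vertex to a child either stays in the same component of `H` or at least
halves the subtree size, then subtree sizes decay exponentially in the number of components
of `H` met by a path from the root. -/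
lemma IsAcyclic.two_pow_ncard_mul_ncard_rootedSubtree_le [Finite V] (hG : G.IsAcyclic) {r : V}
    {H : SimpleGraph V}
    (hstep : ∀ u w, G.Adj u w → w ∈ G.rootedSubtree r u →
      H.connectedComponentMk u = H.connectedComponentMk w ∨
        2 * (G.rootedSubtree r w).ncard ≤ (G.rootedSubtree r u).ncard)
    {v : V} (p : G.Walk r v) (hp : p.IsPath) :
    2 ^ (H.connectedComponentMk '' {x | x ∈ p.support}).ncard * (G.rootedSubtree r v).ncard
      ≤ 2 * Nat.card V := by
  induction p using Walk.concatRec with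
  | Hnil => simpa using Set.ncard_le_card _
  | @Hconcat r u w p huw ih =>
    obtain ⟨hp', hw⟩ := (Walk.concat_isPath_iff huw).1 hp
    have ih := ih hstep hp'
    have hmem : w ∈ G.rootedSubtree r u :=
      hG.mem_rootedSubtree_of_isPath hp (by simp [Walk.support_concat])
    have hset : H.connectedComponentMk '' {x | x ∈ (p.concat huw).support} =
        insert (H.connectedComponentMk w) (H.connectedComponentMk '' {x | x ∈ p.support}) := by
      rw [← Set.image_insert_eq]
      congr 1
      ext x
      simp [Walk.support_concat, or_comm]
    rw [hset]
    rcases hstep u w huw hmem with hc | hc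
    · rw [Set.insert_eq_of_mem (hc ▸ Set.mem_image_of_mem _ p.end_mem_support)]
      exact (Nat.mul_le_mul_left _ (Set.ncard_le_ncard (rootedSubtree_subset_of_mem hmem))).trans ih
    · refine le_trans ?_ ih
      calc _ ≤ 2 ^ ((H.connectedComponentMk '' {x | x ∈ p.support}).ncard + 1) *
            (G.rootedSubtree r w).ncard :=
          Nat.mul_le_mul_right _ (Nat.pow_le_pow_right two_pos (Set.ncard_insert_le _ _))
        _ ≤ _ := by
          rw [pow_succ, mul_assoc]
          exact Nat.mul_le_mul_left _ hc

end SimpleGraph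

/-- In a finite rooted tree on `n` vertices with heavy path decomposition given by the
connected components of the graph `H` of heavy edges, every root-to-vertex path meets
at most `⌊log₂ n⌋ + 1` distinct heavy paths (components of `H`). -/
theorem root_path_meets_few_heavy_paths {V : Type*} [Fintype V]
    (G : SimpleGraph V) (hG : G.IsTree) (r : V)
    (sz : V → ℕ)
    (hsz : ∀ x : V, sz x = Set.ncard {y : V | ∀ p : G.Path r y, x ∈ p.1.support})
    (IsChild : V → V → Prop)
    (hchild : ∀ u v : V, IsChild u v ↔ (G.Adj u v ∧ ∀ p : G.Path r v, u ∈ p.1.support))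
    (hfun : V → V)
    (hheavy : ∀ u : V, (∃ v : V, IsChild u v) →
      IsChild u (hfun u) ∧ ∀ v : V, IsChild u v → sz v ≤ sz (hfun u))
    (H : SimpleGraph V)
    (hH : H = SimpleGraph.fromEdgeSet
      {e : Sym2 V | ∃ u : V, (∃ v : V, IsChild u v) ∧ e = s(u, hfun u)}) :
    ∀ (v : V) (p : G.Path r v),
      Set.ncard {c : H.ConnectedComponent | ∃ x ∈ p.1.support, H.connectedComponentMk x = c}
        ≤ Nat.log 2 (Fintype.card V) + 1 := by
  intro v p
  have hstep : ∀ u w, G.Adj u w → w ∈ G.rootedSubtree r u →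
      H.connectedComponentMk u = H.connectedComponentMk w ∨
        2 * (G.rootedSubtree r w).ncard ≤ (G.rootedSubtree r u).ncard := by
    intro u w huw hmem
    have hc : IsChild u w := (hchild u w).2 ⟨huw, hmem⟩
    obtain ⟨hh, hmax⟩ := hheavy u ⟨w, hc⟩
    obtain ⟨huh, hmemh⟩ := (hchild u (hfun u)).1 hh
    by_cases hw : w = hfun u
    · left
      apply ConnectedComponent.sound
      apply Adj.reachable
      rw [hH, fromEdgeSet_adj]
      exact ⟨⟨u, ⟨w, hc⟩, by rw [hw]⟩, huw.ne⟩
    · right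
      have hle := hmax w hc
      rw [hsz, hsz] at hle
      have hunion := Set.ncard_union_eq (hG.disjoint_rootedSubtree huw hmem huh hmemh hw)
      have hsub := Set.ncard_le_ncard (Set.union_subset (rootedSubtree_subset_of_mem hmem)
        (rootedSubtree_subset_of_mem hmemh))
      change (G.rootedSubtree r w).ncard ≤ (G.rootedSubtree r (hfun u)).ncard at hle
      omega
  have key := hG.2.two_pow_ncard_mul_ncard_rootedSubtree_le hstep p.1 p.2
  have hpos : 0 < (G.rootedSubtree r v).ncard :=
    (Set.ncard_pos).2 ⟨v, fun q => q.1.end_mem_support⟩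
  change (H.connectedComponentMk '' {x | x ∈ p.1.support}).ncard ≤ _
  have hn : Nat.card V ≠ 0 := by
    have : Nonempty V := ⟨r⟩
    exact Nat.card_pos.ne'
  rw [← Nat.card_eq_fintype_card, ← Nat.log_mul_base one_lt_two hn]
  refine Nat.le_log_of_pow_le one_lt_two ?_
  rw [mul_comm (Nat.card V)]
  exact (Nat.le_mul_of_pos_right _ hpos).trans key
end

section
/- Let h ≥ 1 be a natural number and let l, r be natural numbers with 0 ≤ l ≤ r < 2^h. Then the set of integers {l, l+1, …, r} can be written as a disjoint union of at most 2h canonical dyadic intervals, where a canonical dyadic interval is a set of the form {j·2^i, j·2^i + 1, …, (j+1)·2^i − 1} for natural numbers i ≤ h and j < 2^{h−i}. -/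
/-- `{a, …, b - 1}` is a disjoint union of at most `n` canonical dyadic intervals of height `h`,
where membership of `x` in the interval of level `i` and index `j` is written `x / 2 ^ i = j`. -/
def HasDyadicPartition (h a b n : ℕ) : Prop :=
  ∃ S : Finset (ℕ × ℕ), S.card ≤ n ∧
    (∀ p ∈ S, p.1 ≤ h ∧ p.2 < 2 ^ (h - p.1)) ∧
    (∀ p ∈ S, ∀ q ∈ S, ∀ x, x / 2 ^ p.1 = p.2 → x / 2 ^ q.1 = q.2 → p = q) ∧
    ∀ x, (∃ p ∈ S, x / 2 ^ p.1 = p.2) ↔ a ≤ x ∧ x < b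

namespace HasDyadicPartition

theorem of_empty {h a b n : ℕ} (hab : b ≤ a) : HasDyadicPartition h a b n := by
  refine ⟨∅, by simp, by simp, by simp, fun x => ?_⟩
  simp only [Finset.notMem_empty, false_and, exists_false, false_iff]
  omega

theorem whole (h : ℕ) : HasDyadicPartition h 0 (2 ^ h) 1 := by
  refine ⟨{(h, 0)}, by simp, by simp, by simp, fun x => ?_⟩
  simp [Nat.div_eq_zero_iff]

theorem double {h a b n : ℕ} (H : HasDyadicPartition h a b n) :
    HasDyadicPartition (h + 1) (2 * a) (2 * b) n := by
  obtain ⟨S, hc, hb, hd, hu⟩ := H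
  have key : ∀ x i : ℕ, x / 2 ^ (i + 1) = x / 2 / 2 ^ i := fun x i => by
    rw [Nat.div_div_eq_div_mul, pow_succ']
  refine ⟨S.image fun p => (p.1 + 1, p.2), Finset.card_image_le.trans hc, ?_, ?_, fun x => ?_⟩
  · simp only [Finset.forall_mem_image]
    intro p hp
    simpa using hb p hp
  · simp only [Finset.forall_mem_image, key]
    intro p hp q hq x hxp hxq
    rw [hd p hp q hq _ hxp hxq]
  · simp only [Finset.exists_mem_image, key, hu]
    omega

theorem insert_point {h a b c a' b' n : ℕ} (H : HasDyadicPartition h a b n) (hc : c < 2 ^ h)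
    (hcab : ¬(a ≤ c ∧ c < b)) (hab' : ∀ x, a' ≤ x ∧ x < b' ↔ x = c ∨ a ≤ x ∧ x < b) :
    HasDyadicPartition h a' b' (n + 1) := by
  obtain ⟨S, hcard, hb, hd, hu⟩ := H
  have hnot : ∀ p ∈ S, c / 2 ^ p.1 ≠ p.2 := fun p hp hx => hcab ((hu c).1 ⟨p, hp, hx⟩)
  refine ⟨insert (0, c) S, (Finset.card_insert_le _ _).trans (by omega), ?_, ?_, fun x => ?_⟩
  · simp only [Finset.forall_mem_insert]
    exact ⟨by simpa using hc, hb⟩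
  · simp only [Finset.forall_mem_insert, pow_zero, Nat.div_one]
    refine ⟨⟨fun _ _ _ => trivial, ?_⟩, fun p hp => ⟨?_, hd p hp⟩⟩
    · rintro q hq x rfl hx
      exact absurd hx (hnot q hq)
    · rintro x hx rfl
      exact absurd hx (hnot p hp)
  · simp only [Finset.exists_mem_insert, pow_zero, Nat.div_one, hu, hab']

end HasDyadicPartition

theorem hasDyadicPartition_two_mul {h : ℕ} (hh : 1 ≤ h) :
    ∀ a b : ℕ, b ≤ 2 ^ h → HasDyadicPartition h a b (2 * h) := by
  induction h, hh using Nat.le_induction with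
  | base =>
    intro a b hb
    by_cases hab : b ≤ a
    · exact .of_empty hab
    have hsingle : b = a + 1 → HasDyadicPartition 1 a b (1 + 1) := fun hb' =>
      (HasDyadicPartition.of_empty (h := 1) (a := 0) (b := 0) (n := 1) le_rfl).insert_point
        (c := a) (by omega) (by omega) (by omega)
    by_cases hb' : b = a + 1
    · exact hsingle hb'
    · obtain ⟨rfl, rfl⟩ : a = 0 ∧ b = 2 := by omega
      obtain ⟨S, hS, H⟩ := HasDyadicPartition.whole 1
      exact ⟨S, by omega, H⟩
  | succ h _ ih =>
    intro a b hb
    rw [pow_succ'] at hb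
    by_cases hab : b ≤ a
    · exact .of_empty hab
    have hpow : 2 ^ (h + 1) = 2 * 2 ^ h := pow_succ' 2 h
    have hmid := (ih ((a + 1) / 2) (b / 2) (by omega)).double
    have hleft : HasDyadicPartition (h + 1) a (2 * (b / 2)) (2 * h + 1) := by
      rcases Nat.even_or_odd' a with ⟨k, rfl | rfl⟩
      · obtain ⟨S, hS, H⟩ := hmid
        rw [show 2 * ((2 * k + 1) / 2) = 2 * k by omega] at H
        exact ⟨S, by omega, H⟩
      · by_cases hk : 2 * (b / 2) ≤ 2 * k + 1
        · exact .of_empty hk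
        · exact hmid.insert_point (c := 2 * k + 1) (by omega) (by omega) (by omega)
    rcases Nat.even_or_odd' b with ⟨k, rfl | rfl⟩
    · obtain ⟨S, hS, H⟩ := hleft
      rw [show 2 * (2 * k / 2) = 2 * k by omega] at H
      exact ⟨S, by omega, H⟩
    · exact hleft.insert_point (c := 2 * k) (by omega) (by omega) (by omega)

theorem mem_Ico_mul_two_pow_iff (x i j : ℕ) :
    x ∈ Set.Ico (j * 2 ^ i) ((j + 1) * 2 ^ i) ↔ x / 2 ^ i = j := by
  have hpos : 0 < 2 ^ i := by positivity
  rw [Set.mem_Ico, ← Nat.le_div_iff_mul_le hpos, ← Nat.div_lt_iff_lt_mul hpos]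
  omega


/-- Any segment `{l, …, r} ⊆ {0, …, 2^h - 1}` (with `h ≥ 1`) is a disjoint union of at most
`2h` canonical dyadic intervals, where the canonical dyadic interval of level `i ≤ h` and
index `j < 2^(h-i)` is `{j·2^i, …, (j+1)·2^i - 1}`. -/
theorem segment_eq_union_of_dyadic_intervals (h l r : ℕ) (hh : 1 ≤ h)
    (hlr : l ≤ r) (hr : r < 2 ^ h) :
    ∃ S : Finset (ℕ × ℕ), S.card ≤ 2 * h ∧
      (∀ p ∈ S, p.1 ≤ h ∧ p.2 < 2 ^ (h - p.1)) ∧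
      (S : Set (ℕ × ℕ)).PairwiseDisjoint
        (fun p : ℕ × ℕ => Set.Ico (p.2 * 2 ^ p.1) ((p.2 + 1) * 2 ^ p.1)) ∧
      (⋃ p ∈ S, Set.Ico (p.2 * 2 ^ p.1) ((p.2 + 1) * 2 ^ p.1)) = Set.Icc l r := by
  obtain ⟨S, hc, hb, hd, hu⟩ := hasDyadicPartition_two_mul hh l (r + 1) hr
  refine ⟨S, hc, hb, fun p hp q hq hpq => ?_, ?_⟩
  · refine Set.disjoint_left.2 fun x hxp hxq => hpq ?_
    exact hd p hp q hq x ((mem_Ico_mul_two_pow_iff _ _ _).1 hxp)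
      ((mem_Ico_mul_two_pow_iff _ _ _).1 hxq)
  · ext x
    simp only [Set.mem_iUnion, mem_Ico_mul_two_pow_iff, exists_prop, hu, Set.mem_Icc,
      Nat.lt_succ_iff]
end
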